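/- Let (M, e, Λ) with Λ < 0 be sub-extremal Reissner–Nordström–AdS parameters with largest horizon radius r_+, α ∈ (−9/4, 0), Δ := √(9/4+α), q₀ ∈ ℝ. There exist C > 0, ε₀ > 0, δ₀ > 0 such that for all ε ∈ (0, ε₀), δ ∈ (0, δ₀) and all C² functions f₁, f₂ on (r_+, ∞) with ‖f₁‖_X ≤ δ and ‖f₂‖_X ≤ δ, if for i = 1, 2 the tuple (κ_i, Ω²_i, ϖ_i, Q_i, A_i) solves the auxiliary system (equations (i)–(v) with φ replaced by f_i) on (r_+, ∞) with the same horizon data (ϖ_i(r_+) = M, Q_i(r_+) = e, κ_i⁻¹(r_+) = 1 − (−Λ/3)α r_+ ε²/(2K_+), A_i(r_+) = 0, lim_{r→r_+} A_i·r²/Ω²_i = e/(2K_+)), then for all r ∈ (r_+, ∞): |κ₁(r) − κ₂(r)| ≤ Cδ‖f₁ − f₂‖_X, |ϖ₁(r) − ϖ₂(r)| ≤ Cδ‖f₁ − f₂‖_X, |Q₁(r) − Q₂(r)| ≤ Cδ‖f₁ − f₂‖_X, and |A₁(r) − A₂(r)| ≤ Cδ‖f₁ − f₂‖_X. -/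

import Mathlib

open Real Set Filter

noncomputable section

/-- The Reissner–Nordström–AdS potential `Ω_RN²(r) = 1 − 2M/r + e²/r² + (−Λ/3)r²`. -/
noncomputable def RNpot (Λ M e r : ℝ) : ℝ := 1 - 2*M/r + e^2/r^2 + (-Λ/3)*r^2

/-- `(M, e, Λ)` are sub-extremal parameters with largest horizon radius `rp`. -/
def IsSubExtremal (Λ M e rp : ℝ) : Prop :=
  0 < rp ∧ RNpot Λ M e rp = 0 ∧
  (∃ r0, 0 < r0 ∧ r0 ≠ rp ∧ RNpot Λ M e r0 = 0) ∧
  ∀ r, 0 < r → RNpot Λ M e r = 0 → r ≤ rp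

/-- The auxiliary (fixed-point) system: equations (i)–(v) of the static
Einstein–Maxwell–(charged) Klein–Gordon system on `(r_+, ∞)`, with the scalar field
replaced by the given source `f`, for the unknowns `(κ, Ω², ϖ, Q, A)`. -/
def AuxSystem (Λ α q0 rp : ℝ) (f κ Ω2 ϖ Q A : ℝ → ℝ) : Prop :=
  ContDiffOn ℝ 1 κ (Set.Ioi rp) ∧ ContDiffOn ℝ 1 Ω2 (Set.Ioi rp) ∧
  ContDiffOn ℝ 1 ϖ (Set.Ioi rp) ∧ ContDiffOn ℝ 1 Q (Set.Ioi rp) ∧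
  ContDiffOn ℝ 1 A (Set.Ioi rp) ∧
  (∀ r ∈ Set.Ioi rp, 0 < κ r) ∧ (∀ r ∈ Set.Ioi rp, 0 < Ω2 r) ∧
  -- (i)
  (∀ r ∈ Set.Ioi rp, deriv κ r / κ r =
      r*(deriv f r)^2 + q0^2*r*(κ r)^2*(A r/Ω2 r)^2*(f r)^2) ∧
  -- (ii)
  (∀ r ∈ Set.Ioi rp, Ω2 r/(κ r)^2 = 1 - 2*ϖ r/r + (Q r)^2/r^2 + (-Λ/3)*r^2) ∧
  -- (iii)
  (∀ r ∈ Set.Ioi rp, deriv ϖ r =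
      (-Λ/3)*α*r^2*(f r)^2/2 + (r^2*(deriv f r)^2/2)*(Ω2 r/(κ r)^2)
      + q0^2*(A r)^2*r^2*(f r)^2/(2*Ω2 r)
      + q0^2*(Q r)*r*(A r/Ω2 r)*(κ r)*(f r)^2) ∧
  -- (iv)
  (∀ r ∈ Set.Ioi rp, deriv Q r = q0^2*r^2*(κ r)*(A r/Ω2 r)*(f r)^2) ∧
  -- (v)
  (∀ r ∈ Set.Ioi rp, deriv A r = Q r * κ r / r^2)

/-- The horizon data for the auxiliary system at `r = r_+` with mass `M`, charge `e`
and perturbation parameter `ε`, attained as limits from `(r_+, ∞)`. -/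
def AuxHorizon (Λ α rp M e ε : ℝ) (κ Ω2 ϖ Q A : ℝ → ℝ) : Prop :=
  ∃ Kp κp : ℝ,
    Kp = M/rp^2 - e^2/rp^3 + (-Λ/3)*rp ∧ 0 < Kp ∧
    κp = (1 - (-Λ/3)*α*rp*ε^2/(2*Kp))⁻¹ ∧
    Filter.Tendsto ϖ (nhdsWithin rp (Set.Ioi rp)) (nhds M) ∧
    Filter.Tendsto Q (nhdsWithin rp (Set.Ioi rp)) (nhds e) ∧
    Filter.Tendsto κ (nhdsWithin rp (Set.Ioi rp)) (nhds κp) ∧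
    Filter.Tendsto (fun r => A r / Ω2 r) (nhdsWithin rp (Set.Ioi rp))
      (nhds (e/(2*Kp*rp^2))) ∧
    Filter.Tendsto (deriv Ω2) (nhdsWithin rp (Set.Ioi rp)) (nhds (2*Kp*κp))

/-- `‖f‖_X ≤ δ`, where `‖f‖_X = sup |r^{3/2+Δ} f| + sup |r^{5/2+Δ} f'| +
sup |r^{3/2+Δ} W f''|` over `(r_+, ∞)` and `W` is the reference potential. -/
def XnormLE (rp Δ : ℝ) (W : ℝ → ℝ) (f : ℝ → ℝ) (δ : ℝ) : Prop :=
  ∃ d1 d2 d3 : ℝ, 0 ≤ d1 ∧ 0 ≤ d2 ∧ 0 ≤ d3 ∧ d1 + d2 + d3 ≤ δ ∧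
    (∀ r ∈ Set.Ioi rp, |r ^ ((3:ℝ)/2 + Δ) * f r| ≤ d1) ∧
    (∀ r ∈ Set.Ioi rp, |r ^ ((5:ℝ)/2 + Δ) * deriv f r| ≤ d2) ∧
    (∀ r ∈ Set.Ioi rp, |r ^ ((3:ℝ)/2 + Δ) * W r * deriv (deriv f) r| ≤ d3)

/-- Comparison of a function with a primitive of a bound for its derivative, the initial
values being one-sided limits. -/
theorem abs_sub_le_of_abs_deriv_le {h h' G G' : ℝ → ℝ} {a h0 K r : ℝ} (hr : a < r)
    (hh : ∀ x, a < x → HasDerivAt h (h' x) x) (hh0 : Tendsto h (nhdsWithin a (Ioi a)) (nhds h0))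
    (hG : ∀ x, a < x → HasDerivAt G (G' x) x) (hG0 : Tendsto G (nhdsWithin a (Ioi a)) (nhds 0))
    (hb : ∀ x ∈ Ioo a r, |h' x| ≤ K * G' x) : |h r - h0| ≤ K * G r := by
  have key : ∀ σ : ℝ, (σ = 1 ∨ σ = -1) → σ * (h r - h0) ≤ K * G r := by
    intro σ hσ
    have hd : ∀ x, a < x → HasDerivAt (fun y => K * G y - σ * h y) (K * G' x - σ * h' x) x :=
      fun x hx => ((hG x hx).const_mul K).sub ((hh x hx).const_mul σ)
    have hmono : MonotoneOn (fun y => K * G y - σ * h y) (Ioc a r) := by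
      refine monotoneOn_of_deriv_nonneg (convex_Ioc a r)
        (fun x hx => (hd x hx.1).continuousAt.continuousWithinAt)
        (fun x hx => ?_) (fun x hx => ?_)
      · rw [interior_Ioc] at hx
        exact (hd x hx.1).differentiableAt.differentiableWithinAt
      · rw [interior_Ioc] at hx
        rw [(hd x hx.1).deriv]
        have := abs_le.1 (hb x hx)
        rcases hσ with rfl | rfl <;> linarith [this.1, this.2]
    have hlim : Tendsto (fun y => K * G y - σ * h y) (nhdsWithin a (Ioi a))
        (nhds (K * 0 - σ * h0)) := (hG0.const_mul K).sub (hh0.const_mul σ)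
    have hle : K * 0 - σ * h0 ≤ K * G r - σ * h r := by
      refine le_of_tendsto hlim ?_
      filter_upwards [Ioo_mem_nhdsGT hr] with x hx
      exact hmono ⟨hx.1, hx.2.le⟩ ⟨hr, le_rfl⟩ hx.2.le
    linarith
  rw [abs_le]
  have h1 := key 1 (Or.inl rfl)
  have h2 := key (-1) (Or.inr rfl)
  constructor <;> linarith

/-- Continuity method on a half-line: a strict bound that holds near the end point and that
improves the corresponding weak bound holds everywhere. -/
theorem lt_one_of_bootstrap {m : ℝ → ℝ} {a : ℝ} (hc : ContinuousOn m (Ioi a))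
    (h0 : ∀ᶠ x in nhdsWithin a (Ioi a), m x < 1)
    (himp : ∀ r, a < r → (∀ x ∈ Ioo a r, m x ≤ 1) → m r < 1) :
    ∀ r, a < r → m r < 1 := by
  by_contra! hcon
  obtain ⟨r, hr, hmr⟩ := hcon
  set S : Set ℝ := {x | a < x ∧ 1 ≤ m x} with hS
  have hne : S.Nonempty := ⟨r, hr, hmr⟩
  have hbd : BddBelow S := ⟨a, fun x hx => hx.1.le⟩
  obtain ⟨b, hb, hbm⟩ := (mem_nhdsGT_iff_exists_Ioo_subset).1 h0
  have hb' : a < b := hb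
  have hinf : b ≤ sInf S := by
    refine le_csInf hne fun x hx => ?_
    by_contra! hxb
    exact absurd (hbm ⟨hx.1, hxb⟩) (not_lt.2 hx.2)
  have has : a < sInf S := hb'.trans_le hinf
  have hlt : m (sInf S) < 1 := by
    refine himp _ has fun x hx => ?_
    by_contra! hx1
    exact absurd (csInf_le hbd ⟨hx.1, hx1.le⟩) (not_le.2 hx.2)
  have hev : ∀ᶠ x in nhds (sInf S), m x < 1 :=
    (hc.continuousAt (Ioi_mem_nhds has)).eventually (gt_mem_nhds hlt)
  obtain ⟨c, hc1, hc2⟩ := exists_Ico_subset_of_mem_nhds hev ⟨_, lt_add_one _⟩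
  obtain ⟨x, hx, hxc⟩ := exists_lt_of_csInf_lt hne hc1
  exact absurd (hc2 ⟨csInf_le hbd hx, hxc⟩) (not_lt.2 hx.2)

/-- A primitive of `r ^ (-1 - 2Δ)` vanishing at `rp` is controlled by `1 - rp / r`. -/
theorem exists_abs_sub_le_of_rpow_deriv_bound {rp Δ : ℝ} (hrp : 0 < rp) (hΔ : 0 < Δ)
    (hΔ' : Δ ≤ 3 / 2) :
    ∃ T : ℝ, 0 < T ∧ ∀ (h h' : ℝ → ℝ) (h0 K r : ℝ), rp < r → 0 ≤ K →
      (∀ x, rp < x → HasDerivAt h (h' x) x) → Tendsto h (nhdsWithin rp (Ioi rp)) (nhds h0) →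
      (∀ x ∈ Ioo rp r, |h' x| ≤ K * x ^ (-1 - 2 * Δ)) →
      |h r - h0| ≤ T * K * (1 - rp / r) := by
  have h2Δ : (0:ℝ) < 2 * Δ := by positivity
  have hp : 0 < rp ^ (-(2 * Δ)) := rpow_pos_of_pos hrp _
  refine ⟨rp ^ (-(2 * Δ)) * 3 / (2 * Δ), by positivity, ?_⟩
  intro h h' h0 K r hr hK hd hl hb
  have hr0 : 0 < r := hrp.trans hr
  have hG : ∀ x, rp < x → HasDerivAt
      (fun x : ℝ => (rp ^ (-(2 * Δ)) - x ^ (-(2 * Δ))) / (2 * Δ)) (x ^ (-1 - 2 * Δ)) x := by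
    intro x hx
    have h1 := Real.hasDerivAt_rpow_const (x := x) (p := -(2 * Δ)) (Or.inl (hrp.trans hx).ne')
    have h2 := (h1.const_sub (rp ^ (-(2 * Δ)))).div_const (2 * Δ)
    refine h2.congr_deriv ?_
    rw [show -(2 * Δ) - 1 = -1 - 2 * Δ by ring]
    field_simp
  have hG0 : Tendsto (fun x : ℝ => (rp ^ (-(2 * Δ)) - x ^ (-(2 * Δ))) / (2 * Δ))
      (nhdsWithin rp (Ioi rp)) (nhds 0) := by
    have h1 : ContinuousAt (fun x : ℝ => (rp ^ (-(2 * Δ)) - x ^ (-(2 * Δ))) / (2 * Δ)) rp :=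
      (continuousAt_const.sub (Real.continuousAt_rpow_const _ _ (Or.inl hrp.ne'))).div_const _
    have h2 := h1.tendsto
    simp only [sub_self, zero_div] at h2
    exact h2.mono_left nhdsWithin_le_nhds
  refine (abs_sub_le_of_abs_deriv_le hr hd hl hG hG0 hb).trans ?_
  set x := rp / r with hx
  have hx0 : 0 < x := by positivity
  have hx1 : x ≤ 1 := (div_le_one hr0).2 hr.le
  have e1 : r ^ (-(2 * Δ)) = rp ^ (-(2 * Δ)) * x ^ (2 * Δ) := by
    rw [hx, Real.div_rpow hrp.le hr0.le, Real.rpow_neg hrp.le, Real.rpow_neg hr0.le]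
    have : rp ^ (2 * Δ) ≠ 0 := (rpow_pos_of_pos hrp _).ne'
    field_simp
  have e2 : x ^ (3:ℝ) ≤ x ^ (2 * Δ) :=
    Real.rpow_le_rpow_of_exponent_ge hx0 hx1 (by linarith)
  have e3 : x ^ (3:ℝ) = x ^ 3 := by exact_mod_cast Real.rpow_natCast x 3
  have e4 : 1 - x ^ (2 * Δ) ≤ 3 * (1 - x) := by
    rw [e3] at e2
    nlinarith [mul_nonneg (sq_nonneg (x - 1)) (by linarith : (0:ℝ) ≤ x + 2)]
  rw [e1]
  calc K * ((rp ^ (-(2 * Δ)) - rp ^ (-(2 * Δ)) * x ^ (2 * Δ)) / (2 * Δ))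
      = K * rp ^ (-(2 * Δ)) / (2 * Δ) * (1 - x ^ (2 * Δ)) := by ring
    _ ≤ K * rp ^ (-(2 * Δ)) / (2 * Δ) * (3 * (1 - x)) := by gcongr
    _ = _ := by ring

/-- The same comparison for functions with derivative `O(r ^ (-2))`. -/
theorem abs_sub_le_of_inv_sq_deriv_bound {rp : ℝ} (hrp : 0 < rp) {h h' : ℝ → ℝ} {h0 K r : ℝ}
    (hr : rp < r) (hd : ∀ x, rp < x → HasDerivAt h (h' x) x)
    (hl : Tendsto h (nhdsWithin rp (Ioi rp)) (nhds h0))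
    (hb : ∀ x ∈ Ioo rp r, |h' x| ≤ K * x⁻¹ ^ 2) :
    |h r - h0| ≤ K * rp⁻¹ * (1 - rp / r) := by
  have hr0 : 0 < r := hrp.trans hr
  have hG : ∀ x, rp < x → HasDerivAt (fun x : ℝ => rp⁻¹ - x⁻¹) (x⁻¹ ^ 2) x := by
    intro x hx
    have h1 := (hasDerivAt_inv (hrp.trans hx).ne').const_sub rp⁻¹
    exact h1.congr_deriv (by rw [neg_neg, inv_pow])
  have hG0 : Tendsto (fun x : ℝ => rp⁻¹ - x⁻¹) (nhdsWithin rp (Ioi rp)) (nhds 0) := by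
    have h1 : ContinuousAt (fun x : ℝ => rp⁻¹ - x⁻¹) rp :=
      continuousAt_const.sub (continuousAt_inv₀ hrp.ne')
    have h2 := h1.tendsto
    simp only [sub_self] at h2
    exact h2.mono_left nhdsWithin_le_nhds
  refine (abs_sub_le_of_abs_deriv_le hr hd hl hG hG0 hb).trans (le_of_eq ?_)
  field_simp

/-- `x` and `y` behave like monomials of degree `j` in quantities bounded by `K` and at
distance at most `K * N`. -/
def NearDeg (K N : ℝ) (j : ℕ) (x y : ℝ) : Prop :=
  |x| ≤ K ^ j ∧ |y| ≤ K ^ j ∧ |x - y| ≤ j * K ^ j * N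

theorem NearDeg.mul {K N : ℝ} (hK : 0 ≤ K) {i j : ℕ} {x y x' y' : ℝ}
    (h : NearDeg K N i x y) (h' : NearDeg K N j x' y') : NearDeg K N (i + j) (x * x') (y * y') := by
  obtain ⟨h1, h2, h3⟩ := h
  obtain ⟨h1', h2', h3'⟩ := h'
  refine ⟨?_, ?_, ?_⟩
  · rw [abs_mul, pow_add]; gcongr
  · rw [abs_mul, pow_add]; gcongr
  · calc |x * x' - y * y'| = |x * (x' - y') + (x - y) * y'| := by ring_nf
      _ ≤ |x| * |x' - y'| + |x - y| * |y'| := by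
        rw [← abs_mul, ← abs_mul]; exact abs_add_le _ _
      _ ≤ K ^ i * (j * K ^ j * N) + (i * K ^ i * N) * K ^ j := by
        gcongr
        exact (abs_nonneg _).trans h3
      _ = _ := by push_cast; ring

theorem NearDeg.pow {K N : ℝ} (hK : 0 ≤ K) {x y : ℝ} (h : NearDeg K N 1 x y) (n : ℕ) :
    NearDeg K N n (x ^ n) (y ^ n) := by
  induction n with
  | zero => simp [NearDeg]
  | succ n ih => simpa only [pow_succ] using ih.mul hK h

theorem NearDeg.refl {K N x : ℝ} (hK : 0 ≤ K) (hN : 0 ≤ N) (h : |x| ≤ K) :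
    NearDeg K N 1 x x := by
  refine ⟨by simpa using h, by simpa using h, ?_⟩
  simp only [sub_self, abs_zero]
  positivity

theorem NearDeg.mul_sq_sub {K N δ η : ℝ} (hK : 1 ≤ K) (hN : 0 ≤ N) {j : ℕ}
    (hj : j ≤ 12) {x y a a' : ℝ} (h : NearDeg K N j x y) (ha : |a| ≤ δ) (ha' : |a'| ≤ δ)
    (haa : |a - a'| ≤ η) : |x * a ^ 2 - y * a' ^ 2| ≤ 12 * K ^ 12 * (δ ^ 2 * N + δ * η) := by
  obtain ⟨h1, h2, h3⟩ := h
  have hδ : 0 ≤ δ := (abs_nonneg _).trans ha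
  have hη : 0 ≤ η := (abs_nonneg _).trans haa
  have hp : K ^ j ≤ K ^ 12 := pow_le_pow_right₀ hK hj
  have hj' : (j : ℝ) ≤ 12 := by exact_mod_cast hj
  have hK0 : 0 ≤ K := by linarith
  have ha2 : |a ^ 2| ≤ δ ^ 2 := by rw [abs_pow]; gcongr
  have hdiff : |a ^ 2 - a' ^ 2| ≤ 2 * δ * η := by
    rw [show a ^ 2 - a' ^ 2 = (a + a') * (a - a') by ring, abs_mul]
    gcongr
    linarith [abs_add_le a a']
  calc |x * a ^ 2 - y * a' ^ 2| = |(x - y) * a ^ 2 + y * (a ^ 2 - a' ^ 2)| := by ring_nf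
    _ ≤ |x - y| * |a ^ 2| + |y| * |a ^ 2 - a' ^ 2| := by
      rw [← abs_mul, ← abs_mul]; exact abs_add_le _ _
    _ ≤ (j * K ^ j * N) * δ ^ 2 + K ^ j * (2 * δ * η) := by gcongr
    _ ≤ (12 * K ^ 12 * N) * δ ^ 2 + K ^ 12 * (12 * δ * η) := by gcongr; norm_num
    _ = _ := by ring

/-- The right-hand side of the equation for `κ`, without the factor `r ^ (-1 - 2Δ)`. -/
def rhsκ (q u κ p a b : ℝ) : ℝ := κ * u ^ 3 * b ^ 2 + q * κ ^ 3 * p ^ 2 * u ^ 5 * a ^ 2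

/-- The right-hand side of the equation for `ϖ`, without the factor `r ^ (-1 - 2Δ)`. -/
def rhsϖ (m q u κ Q p H a b : ℝ) : ℝ :=
  m * a ^ 2 + 1 / 2 * (H * b ^ 2) + 1 / 2 * (q * κ ^ 2 * H * p ^ 2 * u ^ 2 * a ^ 2)
    + q * Q * p * κ * u ^ 3 * a ^ 2

/-- The right-hand side of the equation for `Q`, without the factor `r ^ (-1 - 2Δ)`. -/
def rhsQ (q u κ p a : ℝ) : ℝ := q * κ * p * u ^ 2 * a ^ 2

theorem rhs_sub_le {K N δ η m q u κ κ' Q Q' p p' H H' a a' b b' : ℝ} (hK : 1 ≤ K) (hN : 0 ≤ N)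
    (hm : |m| ≤ K) (hq : |q| ≤ K) (hu : |u| ≤ K) (hκ : NearDeg K N 1 κ κ')
    (hQ : NearDeg K N 1 Q Q') (hp : NearDeg K N 1 p p') (hH : NearDeg K N 1 H H')
    (ha : |a| ≤ δ) (ha' : |a'| ≤ δ) (haa : |a - a'| ≤ η)
    (hb : |b| ≤ δ) (hb' : |b'| ≤ δ) (hbb : |b - b'| ≤ η) :
    |rhsκ q u κ p a b - rhsκ q u κ' p' a' b'| ≤ 48 * K ^ 12 * (δ ^ 2 * N + δ * η) ∧
    |rhsϖ m q u κ Q p H a b - rhsϖ m q u κ' Q' p' H' a' b'|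
      ≤ 48 * K ^ 12 * (δ ^ 2 * N + δ * η) ∧
    |rhsQ q u κ p a - rhsQ q u κ' p' a'| ≤ 48 * K ^ 12 * (δ ^ 2 * N + δ * η) := by
  have hK0 : 0 ≤ K := by linarith
  have hδ : 0 ≤ δ := (abs_nonneg _).trans ha
  have hη : 0 ≤ η := (abs_nonneg _).trans haa
  have nm := NearDeg.refl hK0 hN hm
  have nq := NearDeg.refl hK0 hN hq
  have nu := NearDeg.refl hK0 hN hu
  have k1 := ((hκ.mul hK0 (nu.pow hK0 3))).mul_sq_sub hK hN (by norm_num) hb hb' hbb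
  have k2 := ((((nq.mul hK0 (hκ.pow hK0 3)).mul hK0 (hp.pow hK0 2)).mul hK0
    (nu.pow hK0 5))).mul_sq_sub hK hN (by norm_num) ha ha' haa
  have w1 := nm.mul_sq_sub hK hN (by norm_num) ha ha' haa
  have w2 := hH.mul_sq_sub hK hN (by norm_num) hb hb' hbb
  have w3 := (((((nq.mul hK0 (hκ.pow hK0 2)).mul hK0 hH).mul hK0 (hp.pow hK0 2)).mul hK0
    (nu.pow hK0 2))).mul_sq_sub hK hN (by norm_num) ha ha' haa
  have w4 := (((((nq.mul hK0 hQ).mul hK0 hp).mul hK0 hκ).mul hK0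
    (nu.pow hK0 3))).mul_sq_sub hK hN (by norm_num) ha ha' haa
  have c1 := ((((nq.mul hK0 hκ).mul hK0 hp).mul hK0
    (nu.pow hK0 2))).mul_sq_sub hK hN (by norm_num) ha ha' haa
  rw [show 48 * K ^ 12 * (δ ^ 2 * N + δ * η) = 4 * (12 * K ^ 12 * (δ ^ 2 * N + δ * η)) by ring]
  have E' : 0 ≤ 12 * K ^ 12 * (δ ^ 2 * N + δ * η) := by positivity
  generalize 12 * K ^ 12 * (δ ^ 2 * N + δ * η) = X at *
  rw [abs_le] at k1 k2 w1 w2 w3 w4 c1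
  unfold rhsκ rhsϖ rhsQ
  refine ⟨abs_le.2 ⟨?_, ?_⟩, abs_le.2 ⟨?_, ?_⟩, abs_le.2 ⟨?_, ?_⟩⟩ <;>
    linarith only [k1, k2, w1, w2, w3, w4, c1, E']

theorem rhs_le {K δ m q u κ Q p H a b : ℝ} (hK : 1 ≤ K)
    (hm : |m| ≤ K) (hq : |q| ≤ K) (hu : |u| ≤ K) (hκ : |κ| ≤ K) (hQ : |Q| ≤ K)
    (hp : |p| ≤ K) (hH : |H| ≤ K) (ha : |a| ≤ δ) (hb : |b| ≤ δ) :
    |rhsκ q u κ p a b| ≤ 48 * K ^ 12 * δ ^ 2 ∧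
    |rhsϖ m q u κ Q p H a b| ≤ 48 * K ^ 12 * δ ^ 2 ∧
    |rhsQ q u κ p a| ≤ 48 * K ^ 12 * δ ^ 2 := by
  have hK0 : 0 ≤ K := by linarith
  have hδ : |(0:ℝ)| ≤ δ := by simpa using (abs_nonneg _).trans ha
  have h := rhs_sub_le (a' := 0) (b' := 0) (η := δ) hK le_rfl hm hq hu
    (NearDeg.refl hK0 le_rfl hκ) (NearDeg.refl hK0 le_rfl hQ) (NearDeg.refl hK0 le_rfl hp)
    (NearDeg.refl hK0 le_rfl hH) ha hδ (by simpa using ha) hb hδ (by simpa using hb)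
  simpa [rhsκ, rhsϖ, rhsQ, ← sq] using h

/-- The quantity `Ω² / (κ r) ^ 2` as a function of `u = 1 / r`. -/
def redH (l u ϖ Q : ℝ) : ℝ := l + u ^ 2 - 2 * ϖ * u ^ 3 + Q ^ 2 * u ^ 4

/-- The quantity `r ^ 2 * A / Ω²`. -/
def redP (l : ℝ) (κ ϖ Q A : ℝ → ℝ) (r : ℝ) : ℝ :=
  A r / (κ r ^ 2 * redH l r⁻¹ (ϖ r) (Q r))

/-- The auxiliary system in renormalised variables, with the data at the horizon:
`a = r ^ (3/2 + Δ) f`, `b = r ^ (5/2 + Δ) f'`. -/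
structure RedSystem (rp l m q Δ κp M e p0 δ : ℝ) (a b κ ϖ Q A : ℝ → ℝ) : Prop where
  κ_pos : ∀ r, rp < r → 0 < κ r
  H_pos : ∀ r, rp < r → 0 < redH l r⁻¹ (ϖ r) (Q r)
  κ_deriv : ∀ r, rp < r → HasDerivAt κ
    (r ^ (-1 - 2 * Δ) * rhsκ q r⁻¹ (κ r) (redP l κ ϖ Q A r) (a r) (b r)) r
  ϖ_deriv : ∀ r, rp < r → HasDerivAt ϖ
    (r ^ (-1 - 2 * Δ) * rhsϖ m q r⁻¹ (κ r) (Q r) (redP l κ ϖ Q A r)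
      (redH l r⁻¹ (ϖ r) (Q r)) (a r) (b r)) r
  Q_deriv : ∀ r, rp < r → HasDerivAt Q
    (r ^ (-1 - 2 * Δ) * rhsQ q r⁻¹ (κ r) (redP l κ ϖ Q A r) (a r)) r
  A_deriv : ∀ r, rp < r → HasDerivAt A (Q r * κ r * r⁻¹ ^ 2) r
  κ_lim : Tendsto κ (nhdsWithin rp (Ioi rp)) (nhds κp)
  ϖ_lim : Tendsto ϖ (nhdsWithin rp (Ioi rp)) (nhds M)
  Q_lim : Tendsto Q (nhdsWithin rp (Ioi rp)) (nhds e)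
  A_lim : Tendsto A (nhdsWithin rp (Ioi rp)) (nhds 0)
  P_lim : Tendsto (redP l κ ϖ Q A) (nhdsWithin rp (Ioi rp)) (nhds p0)
  a_le : ∀ r, rp < r → |a r| ≤ δ
  b_le : ∀ r, rp < r → |b r| ≤ δ

theorem exists_mul_le_redH {l rp M e : ℝ} (hl : 0 < l) (hrp : 0 < rp)
    (h0 : RNpot (-3 * l) M e rp = 0) (hK : 0 < M / rp ^ 2 - e ^ 2 / rp ^ 3 + l * rp) :
    ∃ c > 0, ∀ r, rp < r → c * (1 - rp / r) ≤ redH l r⁻¹ M e := by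
  have he : e ^ 2 = -l * rp ^ 4 - rp ^ 2 + 2 * M * rp := by
    unfold RNpot at h0
    field_simp at h0
    linear_combination h0
  have hR : 0 < 4 * l * rp ^ 3 + 2 * rp - 2 * M := by
    rw [he] at hK
    have := mul_pos hK (by positivity : 0 < 2 * rp ^ 2)
    have e1 : (M / rp ^ 2 - (-l * rp ^ 4 - rp ^ 2 + 2 * M * rp) / rp ^ 3 + l * rp) * (2 * rp ^ 2)
        = 4 * l * rp ^ 3 + 2 * rp - 2 * M := by
      field_simp
      ring
    rwa [e1] at this
  refine ⟨min l ((4 * l * rp ^ 3 + 2 * rp - 2 * M) / rp ^ 3), by positivity, fun r hr => ?_⟩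
  have hr0 : 0 < r := hrp.trans hr
  set c := min l ((4 * l * rp ^ 3 + 2 * rp - 2 * M) / rp ^ 3)
  have hc1 : c ≤ l := min_le_left _ _
  have hc2 : c * rp ^ 3 ≤ 4 * l * rp ^ 3 + 2 * rp - 2 * M :=
    (le_div_iff₀ (by positivity)).1 (min_le_right _ _)
  have e1 : redH l r⁻¹ M e =
      (r - rp) * (l * (r ^ 3 + r ^ 2 * rp + r * rp ^ 2 + rp ^ 3) + (r + rp) - 2 * M) / r ^ 4 := by
    unfold redH
    rw [he]
    field_simp
    ring
  have e2 : c * (1 - rp / r) = (r - rp) * (c * r ^ 3) / r ^ 4 := by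
    field_simp
  rw [e1, e2]
  have h3 : rp ^ 3 ≤ r ^ 3 := by gcongr
  have h4 : rp ^ 3 ≤ r ^ 2 * rp := by rw [pow_succ]; gcongr
  have h5 : rp ^ 3 ≤ r * rp ^ 2 := by rw [pow_succ']; gcongr
  have hsub : 0 ≤ r - rp := by linarith
  gcongr
  nlinarith [mul_nonneg (sub_nonneg.2 hc1) (sub_nonneg.2 h3), mul_nonneg hl.le (sub_nonneg.2 h4),
    mul_nonneg hl.le (sub_nonneg.2 h5)]

theorem abs_redH_le {l u u0 ϖ Q X Y : ℝ} (hu : 0 ≤ u) (huu : u ≤ u0) (hϖ : |ϖ| ≤ X)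
    (hQ : |Q| ≤ Y) : |redH l u ϖ Q| ≤ |l| + u0 ^ 2 + 2 * X * u0 ^ 3 + Y ^ 2 * u0 ^ 4 := by
  unfold redH
  have hu0 : 0 ≤ u0 := hu.trans huu
  have h1 : |ϖ * u ^ 3| ≤ X * u0 ^ 3 := by
    rw [abs_mul, abs_of_nonneg (by positivity : 0 ≤ u ^ 3)]
    gcongr
    exact (abs_nonneg _).trans hϖ
  have h2 : |Q ^ 2 * u ^ 4| ≤ Y ^ 2 * u0 ^ 4 := by
    rw [abs_mul, abs_pow, abs_of_nonneg (by positivity : 0 ≤ u ^ 4)]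
    gcongr
  have h3 : u ^ 2 ≤ u0 ^ 2 := by gcongr
  have h4 : 0 ≤ u ^ 2 := by positivity
  have h5 := abs_le.1 h1
  have h6 := abs_le.1 h2
  have h7 := abs_le.1 (le_refl |l|)
  rw [abs_le]
  constructor <;> linarith [h5.1, h5.2, h6.1, h6.2, h7.1, h7.2]

theorem abs_redH_sub_le {l u u0 ϖ ϖ' Q Q' Y d : ℝ} (hu : 0 ≤ u) (huu : u ≤ u0)
    (hQ : |Q| + |Q'| ≤ Y) (dϖ : |ϖ - ϖ'| ≤ d) (dQ : |Q - Q'| ≤ d) :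
    |redH l u ϖ Q - redH l u ϖ' Q'| ≤ (2 * u0 ^ 3 + Y * u0 ^ 4) * d := by
  have hd : 0 ≤ d := (abs_nonneg _).trans dQ
  have hY : 0 ≤ Y := (by positivity : 0 ≤ |Q| + |Q'|).trans hQ
  have hu0 : 0 ≤ u0 := hu.trans huu
  have h1 : |(ϖ - ϖ') * u ^ 3| ≤ d * u0 ^ 3 := by
    rw [abs_mul, abs_of_nonneg (by positivity : 0 ≤ u ^ 3)]
    gcongr
  have h2 : |(Q + Q') * (Q - Q') * u ^ 4| ≤ Y * d * u0 ^ 4 := by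
    rw [abs_mul, abs_mul, abs_of_nonneg (by positivity : 0 ≤ u ^ 4)]
    gcongr
    exact (abs_add_le _ _).trans hQ
  have e1 : redH l u ϖ Q - redH l u ϖ' Q'
      = (Q + Q') * (Q - Q') * u ^ 4 - 2 * ((ϖ - ϖ') * u ^ 3) := by
    unfold redH; ring
  rw [e1]
  have h5 := abs_le.1 h1
  have h6 := abs_le.1 h2
  rw [abs_le]
  constructor <;> linarith [h5.1, h5.2, h6.1, h6.2]

theorem RedSystem.continuousOn_redP {rp l m q Δ κp M e p0 δ : ℝ} {a b κ ϖ Q A : ℝ → ℝ}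
    (hrp : 0 < rp) (h : RedSystem rp l m q Δ κp M e p0 δ a b κ ϖ Q A) :
    ContinuousOn (redP l κ ϖ Q A) (Ioi rp) := by
  intro r hr
  have hr' : rp < r := hr
  have c1 := (h.κ_deriv r hr').continuousAt
  have c2 := (h.ϖ_deriv r hr').continuousAt
  have c3 := (h.Q_deriv r hr').continuousAt
  have c4 := (h.A_deriv r hr').continuousAt
  have c5 : ContinuousAt (fun x : ℝ => x⁻¹) r := continuousAt_inv₀ (hrp.trans hr').ne'
  have c6 : ContinuousAt (fun x => κ x ^ 2 * redH l x⁻¹ (ϖ x) (Q x)) r := by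
    unfold redH
    fun_prop
  have hne : κ r ^ 2 * redH l r⁻¹ (ϖ r) (Q r) ≠ 0 :=
    (mul_pos (pow_pos (h.κ_pos r hr') 2) (h.H_pos r hr')).ne'
  exact (c4.div c6 hne).continuousWithinAt

/-- Uniform bounds at `r` from weaker bounds on `(rp, r)`. -/
theorem RedSystem.improve {rp l m q Δ κp M e p0 δ B K T c r : ℝ} {a b κ ϖ Q A : ℝ → ℝ}
    (h : RedSystem rp l m q Δ κp M e p0 δ a b κ ϖ Q A) (hrp : 0 < rp)
    (hT : ∀ (h h' : ℝ → ℝ) (h0 K r : ℝ), rp < r → 0 ≤ K →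
      (∀ x, rp < x → HasDerivAt h (h' x) x) → Tendsto h (nhdsWithin rp (Ioi rp)) (nhds h0) →
      (∀ x ∈ Ioo rp r, |h' x| ≤ K * x ^ (-1 - 2 * Δ)) →
      |h r - h0| ≤ T * K * (1 - rp / r)) (hc : 0 < c)
    (hcH : ∀ r, rp < r → c * (1 - rp / r) ≤ redH l r⁻¹ M e)
    (hκp : 1 / 2 ≤ κp) (hκp' : κp ≤ 1) (hK2 : 2 ≤ K) (hKe : |e| + 1 ≤ K) (hKB : B ≤ K)
    (hKH : |l| + rp⁻¹ ^ 2 + 2 * (|M| + 1) * rp⁻¹ ^ 3 + (|e| + 1) ^ 2 * rp⁻¹ ^ 4 ≤ K)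
    (hKm : |m| ≤ K) (hKq : |q| ≤ K) (hKu : rp⁻¹ ≤ K)
    (hδ1 : T * (48 * K ^ 12 * δ ^ 2) ≤ 1 / 8)
    (hδ2 : (2 * rp⁻¹ ^ 3 + (2 * |e| + 1) * rp⁻¹ ^ 4) * (T * (48 * K ^ 12 * δ ^ 2)) ≤ c / 2)
    (hr : rp < r)
    (hboot : ∀ x ∈ Ioo rp r, |Q x - e| ≤ 1 ∧ |ϖ x - M| ≤ 1 ∧ |κ x - κp| ≤ 1 / 4 ∧
      |redP l κ ϖ Q A x| ≤ B) :
    |Q r - e| ≤ 1 / 8 * (1 - rp / r) ∧ |ϖ r - M| ≤ 1 / 8 * (1 - rp / r) ∧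
    |κ r - κp| ≤ 1 / 8 * (1 - rp / r) ∧ c / 32 * (1 - rp / r) ≤ κ r ^ 2 * redH l r⁻¹ (ϖ r) (Q r) ∧
    |A r| ≤ (|e| + 1) * (5 / 4) * rp⁻¹ * (1 - rp / r) ∧
    |redP l κ ϖ Q A r| ≤ 40 * (|e| + 1) * rp⁻¹ / c := by
  have hr0 : 0 < r := hrp.trans hr
  have ht0 : 0 < 1 - rp / r := by rw [sub_pos, div_lt_one hr0]; exact hr
  have ht1 : 1 - rp / r ≤ 1 := by
    have : 0 < rp / r := by positivity
    linarith
  have hu0 : 0 < r⁻¹ := by positivity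
  have hu1 : r⁻¹ ≤ rp⁻¹ := inv_anti₀ hrp hr.le
  have hnear : ∀ x ∈ Ioo rp r, |Q x| ≤ |e| + 1 ∧ |κ x| ≤ 5 / 4 := by
    intro x hx
    obtain ⟨h1, h2, h3, h4⟩ := hboot x hx
    constructor
    · have := abs_sub_abs_le_abs_sub (Q x) e
      linarith
    · rw [abs_le] at *
      constructor <;> linarith [h3.1, h3.2]
  have hrhs : ∀ x ∈ Ioo rp r,
      |rhsκ q x⁻¹ (κ x) (redP l κ ϖ Q A x) (a x) (b x)| ≤ 48 * K ^ 12 * δ ^ 2 ∧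
      |rhsϖ m q x⁻¹ (κ x) (Q x) (redP l κ ϖ Q A x) (redH l x⁻¹ (ϖ x) (Q x)) (a x) (b x)|
        ≤ 48 * K ^ 12 * δ ^ 2 ∧
      |rhsQ q x⁻¹ (κ x) (redP l κ ϖ Q A x) (a x)| ≤ 48 * K ^ 12 * δ ^ 2 := by
    intro x hx
    obtain ⟨h1, h2, h3, h4⟩ := hboot x hx
    obtain ⟨h5, h6⟩ := hnear x hx
    have hx0 : 0 < x := hrp.trans hx.1
    have hux : x⁻¹ ≤ rp⁻¹ := inv_anti₀ hrp hx.1.le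
    have hux0 : 0 < x⁻¹ := by positivity
    have h7 : |ϖ x| ≤ |M| + 1 := by
      have := abs_sub_abs_le_abs_sub (ϖ x) M
      linarith
    refine rhs_le (by linarith) hKm hKq ?_ (by linarith) (by linarith) (by linarith)
      ((abs_redH_le hux0.le hux h7 h5).trans hKH) (h.a_le x hx.1) (h.b_le x hx.1)
    rw [abs_of_pos hux0]
    linarith
  have hKδ : 0 ≤ 48 * K ^ 12 * δ ^ 2 := by positivity
  have hgen : ∀ (g R : ℝ → ℝ) (g0 : ℝ),
      (∀ x, rp < x → HasDerivAt g (x ^ (-1 - 2 * Δ) * R x) x) →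
      Tendsto g (nhdsWithin rp (Ioi rp)) (nhds g0) →
      (∀ x ∈ Ioo rp r, |R x| ≤ 48 * K ^ 12 * δ ^ 2) →
      |g r - g0| ≤ T * (48 * K ^ 12 * δ ^ 2) * (1 - rp / r) := by
    intro g R g0 hg hg0 hR
    refine hT g _ g0 _ r hr hKδ hg hg0 fun x hx => ?_
    have hs : 0 < x ^ (-1 - 2 * Δ) := rpow_pos_of_pos (hrp.trans hx.1) _
    rw [abs_mul, abs_of_pos hs, mul_comm]
    gcongr
    exact hR x hx
  have dκ := hgen κ _ κp h.κ_deriv h.κ_lim fun x hx => (hrhs x hx).1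
  have dϖ := hgen ϖ _ M h.ϖ_deriv h.ϖ_lim fun x hx => (hrhs x hx).2.1
  have dQ := hgen Q _ e h.Q_deriv h.Q_lim fun x hx => (hrhs x hx).2.2
  set θ := T * (48 * K ^ 12 * δ ^ 2) with hθ
  have hθt : θ * (1 - rp / r) ≤ 1 / 8 * (1 - rp / r) := by gcongr
  have dκ' := dκ.trans hθt
  have dϖ' := dϖ.trans hθt
  have dQ' := dQ.trans hθt
  have hQr : |Q r| + |e| ≤ 2 * |e| + 1 := by
    have := abs_sub_abs_le_abs_sub (Q r) e
    linarith
  have hHd := abs_redH_sub_le (l := l) hu0.le hu1 hQr dϖ dQ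
  have hHd' : |redH l r⁻¹ (ϖ r) (Q r) - redH l r⁻¹ M e| ≤ c / 2 * (1 - rp / r) := by
    refine hHd.trans ?_
    rw [← mul_assoc]
    gcongr
  have hHlow : c / 2 * (1 - rp / r) ≤ redH l r⁻¹ (ϖ r) (Q r) := by
    have := (abs_le.1 hHd').1
    linarith [hcH r hr]
  have hκlow : 1 / 4 ≤ κ r := by
    have := (abs_le.1 dκ').1
    linarith
  have hD : c / 32 * (1 - rp / r) ≤ κ r ^ 2 * redH l r⁻¹ (ϖ r) (Q r) := by
    calc c / 32 * (1 - rp / r) = (1 / 4) ^ 2 * (c / 2 * (1 - rp / r)) := by ring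
      _ ≤ _ := by gcongr
  have hA : |A r| ≤ (|e| + 1) * (5 / 4) * rp⁻¹ * (1 - rp / r) := by
    have := abs_sub_le_of_inv_sq_deriv_bound (K := (|e| + 1) * (5 / 4)) hrp hr h.A_deriv h.A_lim
      (fun x hx => by
        obtain ⟨h5, h6⟩ := hnear x hx
        rw [abs_mul, abs_mul, abs_of_nonneg (by positivity : 0 ≤ x⁻¹ ^ 2)]
        gcongr)
    simpa using this
  refine ⟨dQ', dϖ', dκ', hD, hA, ?_⟩
  have hDpos : 0 < κ r ^ 2 * redH l r⁻¹ (ϖ r) (Q r) := lt_of_lt_of_le (by positivity) hD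
  unfold redP
  rw [abs_div, abs_of_pos hDpos, div_le_iff₀ hDpos]
  calc |A r| ≤ (|e| + 1) * (5 / 4) * rp⁻¹ * (1 - rp / r) := hA
    _ = 40 * (|e| + 1) * rp⁻¹ / c * (c / 32 * (1 - rp / r)) := by field_simp; ring
    _ ≤ _ := by gcongr

/-- Bounds for the renormalised system that are uniform for small scalar sources. -/
theorem exists_redSystem_bounds {rp l m q Δ M e p0 : ℝ} (hrp : 0 < rp) (hΔ : 0 < Δ)
    (hΔ' : Δ ≤ 3 / 2) (hl : 0 < l) (h0 : RNpot (-3 * l) M e rp = 0)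
    (hKp : 0 < M / rp ^ 2 - e ^ 2 / rp ^ 3 + l * rp) :
    ∃ K c δ₀ : ℝ, 2 ≤ K ∧ |m| ≤ K ∧ |q| ≤ K ∧ rp⁻¹ ≤ K ∧ 0 < c ∧ 0 < δ₀ ∧
      ∀ (κp δ : ℝ) (a b κ ϖ Q A : ℝ → ℝ), 1 / 2 ≤ κp → κp ≤ 1 → 0 < δ → δ < δ₀ →
      RedSystem rp l m q Δ κp M e p0 δ a b κ ϖ Q A → ∀ r, rp < r →
        |κ r| ≤ K ∧ |Q r| ≤ K ∧ |redP l κ ϖ Q A r| ≤ K ∧ |redH l r⁻¹ (ϖ r) (Q r)| ≤ K ∧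
        c * (1 - rp / r) ≤ κ r ^ 2 * redH l r⁻¹ (ϖ r) (Q r) ∧ |A r| ≤ K * (1 - rp / r) ∧
        |κ r - κp| ≤ 1 - rp / r ∧ |ϖ r - M| ≤ 1 - rp / r ∧ |Q r - e| ≤ 1 - rp / r := by
  obtain ⟨T, hT0, hT⟩ := exists_abs_sub_le_of_rpow_deriv_bound hrp hΔ hΔ'
  obtain ⟨c, hc, hcH⟩ := exists_mul_le_redH hl hrp h0 hKp
  have hu : 0 < rp⁻¹ := by positivity
  obtain ⟨B0, hB0⟩ : ∃ B0, B0 = 40 * (|e| + 1) * rp⁻¹ / c := ⟨_, rfl⟩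
  have hB0pos : 0 < B0 := by rw [hB0]; positivity
  obtain ⟨B, hB⟩ : ∃ B, B = B0 + |p0| + 1 := ⟨_, rfl⟩
  have hp0 := abs_nonneg p0
  have hBpos : 0 < B := by linarith
  obtain ⟨X, hX⟩ : ∃ X, X = |l| + rp⁻¹ ^ 2 + 2 * (|M| + 1) * rp⁻¹ ^ 3
    + (|e| + 1) ^ 2 * rp⁻¹ ^ 4 := ⟨_, rfl⟩
  have hXpos : 0 < X := by rw [hX]; positivity
  obtain ⟨Y, hY⟩ : ∃ Y, Y = (|e| + 1) * (5 / 4) * rp⁻¹ := ⟨_, rfl⟩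
  have hYpos : 0 < Y := by rw [hY]; positivity
  have he := abs_nonneg e
  have hm := abs_nonneg m
  have hq := abs_nonneg q
  obtain ⟨K, hK⟩ : ∃ K, K = 2 + |e| + B + X + Y + rp⁻¹ + |m| + |q| := ⟨_, rfl⟩
  have hK2 : 2 ≤ K := by linarith
  obtain ⟨D, hD⟩ : ∃ D, D = T * (48 * K ^ 12) := ⟨_, rfl⟩
  have hDpos : 0 < D := by rw [hD]; positivity
  obtain ⟨E, hE⟩ : ∃ E, E = 2 * rp⁻¹ ^ 3 + (2 * |e| + 1) * rp⁻¹ ^ 4 := ⟨_, rfl⟩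
  have hEpos : 0 < E := by rw [hE]; positivity
  refine ⟨K, c / 32, min 1 (min (1 / 8 / D) (c / 2 / (E * D))), hK2, by linarith, by linarith,
    by linarith, by positivity, by positivity, ?_⟩
  intro κp δ a b κ ϖ Q A hκp hκp' hδ hδ0 hs
  rw [lt_min_iff, lt_min_iff, lt_div_iff₀ hDpos, lt_div_iff₀ (mul_pos hEpos hDpos)] at hδ0
  obtain ⟨hδa, hδb, hδc⟩ := hδ0
  have hδsq : δ ^ 2 ≤ δ := by nlinarith
  have hδ1 : T * (48 * K ^ 12 * δ ^ 2) ≤ 1 / 8 := by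
    have : T * (48 * K ^ 12 * δ ^ 2) = δ ^ 2 * D := by rw [hD]; ring
    rw [this]
    exact (mul_le_mul_of_nonneg_right hδsq hDpos.le).trans hδb.le
  have hδ2 : (2 * rp⁻¹ ^ 3 + (2 * |e| + 1) * rp⁻¹ ^ 4) * (T * (48 * K ^ 12 * δ ^ 2)) ≤ c / 2 := by
    have : T * (48 * K ^ 12 * δ ^ 2) = δ ^ 2 * D := by rw [hD]; ring
    rw [this, ← hE]
    have := mul_le_mul_of_nonneg_right hδsq (mul_pos hEpos hDpos).le
    linarith
  have himp := fun r hr hb => hs.improve (B := B) (r := r) hrp hT hc hcH hκp hκp' hK2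
    (by linarith) (by linarith) (by linarith) (by linarith) (by linarith) (by linarith)
    hδ1 hδ2 hr hb
  have ht : ∀ r, rp < r → 0 < 1 - rp / r ∧ 1 - rp / r ≤ 1 := by
    intro r hr
    have hr0 : 0 < r := hrp.trans hr
    refine ⟨by rw [sub_pos, div_lt_one hr0]; exact hr, ?_⟩
    have : 0 < rp / r := by positivity
    linarith
  have hiff : ∀ x, max (max |Q x - e| |ϖ x - M|)
      (max (4 * |κ x - κp|) (|redP l κ ϖ Q A x| / B)) ≤ 1 →
      |Q x - e| ≤ 1 ∧ |ϖ x - M| ≤ 1 ∧ |κ x - κp| ≤ 1 / 4 ∧ |redP l κ ϖ Q A x| ≤ B := by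
    intro x hx
    simp only [max_le_iff, div_le_one hBpos] at hx
    obtain ⟨⟨h1, h2⟩, h3, h4⟩ := hx
    exact ⟨h1, h2, by linarith, h4⟩
  have hlt := lt_one_of_bootstrap
    (m := fun x => max (max |Q x - e| |ϖ x - M|)
      (max (4 * |κ x - κp|) (|redP l κ ϖ Q A x| / B))) (a := rp) ?_ ?_ ?_
  · intro r hr
    have hb : ∀ x, rp < x → _ := fun x hx => hiff x (hlt x hx).le
    obtain ⟨h1, h2, h3, h4, h5, h6⟩ := himp r hr fun x hx => hb x hx.1
    obtain ⟨g1, g2, g3, g4⟩ := hb r hr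
    obtain ⟨t0, t1⟩ := ht r hr
    have hQ : |Q r| ≤ |e| + 1 := by
      have := abs_sub_abs_le_abs_sub (Q r) e
      linarith
    have hϖ : |ϖ r| ≤ |M| + 1 := by
      have := abs_sub_abs_le_abs_sub (ϖ r) M
      linarith
    have hκ : |κ r| ≤ 5 / 4 := by
      have := abs_le.1 g3
      rw [abs_le]
      constructor <;> linarith [this.1, this.2]
    have hr0 : 0 < r := hrp.trans hr
    have hH := abs_redH_le (l := l) (inv_pos.2 hr0).le (inv_anti₀ hrp hr.le) hϖ hQ
    refine ⟨by linarith, by linarith, by linarith, by linarith, h4, h5.trans ?_, by linarith,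
      by linarith, by linarith⟩
    gcongr
    linarith
  · have c1 : ContinuousOn κ (Ioi rp) :=
      fun x hx => (hs.κ_deriv x hx).continuousAt.continuousWithinAt
    have c2 : ContinuousOn ϖ (Ioi rp) :=
      fun x hx => (hs.ϖ_deriv x hx).continuousAt.continuousWithinAt
    have c3 : ContinuousOn Q (Ioi rp) :=
      fun x hx => (hs.Q_deriv x hx).continuousAt.continuousWithinAt
    have c4 := hs.continuousOn_redP hrp
    exact ((c3.sub continuousOn_const).abs.sup (c2.sub continuousOn_const).abs).sup
      ((continuousOn_const.mul (c1.sub continuousOn_const).abs).sup (c4.abs.div_const B))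
  · have hlim := ((hs.Q_lim.sub_const e).abs.max (hs.ϖ_lim.sub_const M).abs).max
      (((hs.κ_lim.sub_const κp).abs.const_mul 4).max (hs.P_lim.abs.div_const B))
    refine hlim.eventually (gt_mem_nhds ?_)
    simp only [sub_self, abs_zero, mul_zero, max_self, max_lt_iff, zero_lt_one, true_and]
    rw [div_lt_one hBpos]
    linarith
  · intro r hr hb
    obtain ⟨h1, h2, h3, h4, h5, h6⟩ := himp r hr fun x hx => hiff x (hb x hx)
    obtain ⟨t0, t1⟩ := ht r hr
    simp only [max_lt_iff, div_lt_one hBpos]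
    exact ⟨⟨by linarith, by linarith⟩, by linarith, by linarith⟩

theorem abs_div_sub_div_le {x x' y y' c t X Z W : ℝ} (hc : 0 < c) (ht : 0 < t)
    (hy : c * t ≤ y) (hy' : c * t ≤ y') (hx' : |x'| ≤ X * t) (hxx : |x - x'| ≤ Z * t)
    (hyy : |y - y'| ≤ W * t) : |x / y - x' / y'| ≤ Z / c + X * W / c ^ 2 := by
  have hct : 0 < c * t := mul_pos hc ht
  have hy0 : 0 < y := hct.trans_le hy
  have hy0' : 0 < y' := hct.trans_le hy'
  have e1 : x / y - x' / y' = (x - x') / y - x' * (y - y') / (y * y') := by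
    field_simp
    ring
  have h1 : |(x - x') / y| ≤ Z * t / (c * t) := by
    rw [abs_div, abs_of_pos hy0]
    gcongr
    exact (abs_nonneg _).trans hxx
  have h2 : |x' * (y - y') / (y * y')| ≤ X * t * (W * t) / (c * t * (c * t)) := by
    rw [abs_div, abs_mul, abs_of_pos (mul_pos hy0 hy0')]
    have hX := (abs_nonneg _).trans hx'
    have hW := (abs_nonneg _).trans hyy
    gcongr
  rw [e1]
  refine (abs_sub _ _).trans ((add_le_add h1 h2).trans (le_of_eq ?_))
  field_simp

set_option maxHeartbeats 1000000 in
/-- Lipschitz dependence of solutions of the renormalised system on the scalar source. -/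
theorem exists_redSystem_lipschitz {rp l m q Δ M e p0 : ℝ} (hrp : 0 < rp) (hΔ : 0 < Δ)
    (hΔ' : Δ ≤ 3 / 2) (hl : 0 < l) (h0 : RNpot (-3 * l) M e rp = 0)
    (hKp : 0 < M / rp ^ 2 - e ^ 2 / rp ^ 3 + l * rp) :
    ∃ C δ₀ : ℝ, 0 < C ∧ 0 < δ₀ ∧
      ∀ (κp δ η : ℝ) (a b κ ϖ Q A a' b' κ' ϖ' Q' A' : ℝ → ℝ),
      1 / 2 ≤ κp → κp ≤ 1 → 0 < δ → δ < δ₀ →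
      RedSystem rp l m q Δ κp M e p0 δ a b κ ϖ Q A →
      RedSystem rp l m q Δ κp M e p0 δ a' b' κ' ϖ' Q' A' →
      (∀ r, rp < r → |a r - a' r| ≤ η) → (∀ r, rp < r → |b r - b' r| ≤ η) →
      ∀ r, rp < r →
        |κ r - κ' r| ≤ C * δ * η ∧ |ϖ r - ϖ' r| ≤ C * δ * η ∧
        |Q r - Q' r| ≤ C * δ * η ∧ |A r - A' r| ≤ C * δ * η := by
  obtain ⟨T, hT0, hT⟩ := exists_abs_sub_le_of_rpow_deriv_bound hrp hΔ hΔ'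
  obtain ⟨K, c, δ₁, hK2, hKm, hKq, hKu, hc, hδ₁, hbd⟩ :=
    exists_redSystem_bounds (m := m) (q := q) (p0 := p0) hrp hΔ hΔ' hl h0 hKp
  have hK1 : 1 ≤ K := by linarith
  have hK0 : 0 ≤ K := by linarith
  obtain ⟨L, hL⟩ : ∃ L, L = K + 4 * K ^ 5 + (2 * K ^ 2 / c + K * (6 * K ^ 7) / c ^ 2) := ⟨_, rfl⟩
  have hKL : K ≤ L := by
    have : 0 ≤ 4 * K ^ 5 + (2 * K ^ 2 / c + K * (6 * K ^ 7) / c ^ 2) := by positivity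
    linarith
  have hHL : 4 * K ^ 5 ≤ L := by
    have : 0 ≤ 2 * K ^ 2 / c + K * (6 * K ^ 7) / c ^ 2 := by positivity
    linarith
  have hPL : 2 * K ^ 2 / c + K * (6 * K ^ 7) / c ^ 2 ≤ L := by
    have : 0 ≤ 4 * K ^ 5 := by positivity
    linarith
  have hL1 : 1 ≤ L := by linarith
  obtain ⟨D, hD⟩ : ∃ D, D = T * (48 * L ^ 12) := ⟨_, rfl⟩
  have hDpos : 0 < D := by rw [hD]; positivity
  refine ⟨2 * D * (2 * K ^ 2), min δ₁ (min 1 (1 / 2 / D)), by positivity, by positivity, ?_⟩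
  intro κp δ η a b κ ϖ Q A a' b' κ' ϖ' Q' A' hκp hκp' hδ hδ0 hs hs' ha hb
  rw [lt_min_iff, lt_min_iff, lt_div_iff₀ hDpos] at hδ0
  obtain ⟨hδa, hδb, hδc⟩ := hδ0
  have hδsq : D * δ ^ 2 ≤ 1 / 2 := by
    have : δ ^ 2 ≤ δ := by nlinarith
    nlinarith
  have hη : 0 ≤ η := (abs_nonneg _).trans (ha (rp + 1) (by linarith))
  have B := hbd κp δ a b κ ϖ Q A hκp hκp' hδ hδa hs
  have B' := hbd κp δ a' b' κ' ϖ' Q' A' hκp hκp' hδ hδa hs'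
  have ht : ∀ r, rp < r → 0 < 1 - rp / r ∧ 1 - rp / r ≤ 1 := by
    intro r hr
    have hr0 : 0 < r := hrp.trans hr
    refine ⟨by rw [sub_pos, div_lt_one hr0]; exact hr, ?_⟩
    have : 0 < rp / r := by positivity
    linarith
  let V : ℝ → Prop := fun N => ∀ r, rp < r → |κ r - κ' r| ≤ N * (1 - rp / r) ∧
    |ϖ r - ϖ' r| ≤ N * (1 - rp / r) ∧ |Q r - Q' r| ≤ N * (1 - rp / r)
  have hA : ∀ N, 0 ≤ N → V N → ∀ r, rp < r → |A r - A' r| ≤ 2 * K ^ 2 * N * (1 - rp / r) := by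
    intro N hN hV r hr
    have h1 := abs_sub_le_of_inv_sq_deriv_bound (K := 2 * K * N) hrp hr
      (fun x hx => (hs.A_deriv x hx).sub (hs'.A_deriv x hx)) (hs.A_lim.sub hs'.A_lim)
      (fun x hx => by
        obtain ⟨b1, b2, -⟩ := B x hx.1
        obtain ⟨b1', b2', -⟩ := B' x hx.1
        obtain ⟨v1, v2, v3⟩ := hV x hx.1
        obtain ⟨t0, t1⟩ := ht x hx.1
        have hNt : N * (1 - rp / x) ≤ N := mul_le_of_le_one_right hN t1
        rw [← sub_mul, abs_mul, abs_of_nonneg (by positivity : 0 ≤ x⁻¹ ^ 2)]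
        gcongr
        calc |Q x * κ x - Q' x * κ' x| = |(Q x - Q' x) * κ x + Q' x * (κ x - κ' x)| := by ring_nf
          _ ≤ |Q x - Q' x| * |κ x| + |Q' x| * |κ x - κ' x| := by
            rw [← abs_mul, ← abs_mul]; exact abs_add_le _ _
          _ ≤ N * K + K * N := by gcongr <;> linarith
          _ = _ := by ring)
    simp only [Pi.sub_apply, sub_zero] at h1
    refine h1.trans ?_
    have := (ht r hr).1
    calc 2 * K * N * rp⁻¹ * (1 - rp / r) ≤ 2 * K * N * K * (1 - rp / r) := by gcongr
      _ = _ := by ring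
  have hstep : ∀ N, 0 ≤ N → V N → V (D * δ * η + N / 2) := by
    intro N hN hV
    have hAN := hA N hN hV
    have hrhs : ∀ x, rp < x →
        |rhsκ q x⁻¹ (κ x) (redP l κ ϖ Q A x) (a x) (b x)
          - rhsκ q x⁻¹ (κ' x) (redP l κ' ϖ' Q' A' x) (a' x) (b' x)|
          ≤ 48 * L ^ 12 * (δ ^ 2 * N + δ * η) ∧
        |rhsϖ m q x⁻¹ (κ x) (Q x) (redP l κ ϖ Q A x) (redH l x⁻¹ (ϖ x) (Q x)) (a x) (b x)
          - rhsϖ m q x⁻¹ (κ' x) (Q' x) (redP l κ' ϖ' Q' A' x) (redH l x⁻¹ (ϖ' x) (Q' x))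
            (a' x) (b' x)| ≤ 48 * L ^ 12 * (δ ^ 2 * N + δ * η) ∧
        |rhsQ q x⁻¹ (κ x) (redP l κ ϖ Q A x) (a x)
          - rhsQ q x⁻¹ (κ' x) (redP l κ' ϖ' Q' A' x) (a' x)|
          ≤ 48 * L ^ 12 * (δ ^ 2 * N + δ * η) := by
      intro x hx
      obtain ⟨b1, b2, b3, b4, b5, b6, -⟩ := B x hx
      obtain ⟨b1', b2', b3', b4', b5', b6', -⟩ := B' x hx
      obtain ⟨v1, v2, v3⟩ := hV x hx
      obtain ⟨t0, t1⟩ := ht x hx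
      have hNt : N * (1 - rp / x) ≤ N := mul_le_of_le_one_right hN t1
      have hx0 : 0 < x := hrp.trans hx
      have hux : x⁻¹ ≤ rp⁻¹ := inv_anti₀ hrp hx.le
      have hux0 : 0 < x⁻¹ := by positivity
      have hdH : |redH l x⁻¹ (ϖ x) (Q x) - redH l x⁻¹ (ϖ' x) (Q' x)|
          ≤ 4 * K ^ 5 * N * (1 - rp / x) := by
        have h1 := abs_redH_sub_le (l := l) (Y := 2 * K) hux0.le (hux.trans hKu) (by linarith)
          v2 v3
        have h2 : K ^ 3 ≤ K ^ 5 := pow_le_pow_right₀ hK1 (by norm_num)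
        refine h1.trans ?_
        calc (2 * K ^ 3 + 2 * K * K ^ 4) * (N * (1 - rp / x))
            ≤ (2 * K ^ 5 + 2 * K * K ^ 4) * (N * (1 - rp / x)) := by gcongr
          _ = _ := by ring
      have hdD : |κ x ^ 2 * redH l x⁻¹ (ϖ x) (Q x) - κ' x ^ 2 * redH l x⁻¹ (ϖ' x) (Q' x)|
          ≤ 6 * K ^ 7 * N * (1 - rp / x) := by
        have h2 : K ^ 2 ≤ K ^ 7 := pow_le_pow_right₀ hK1 (by norm_num)
        calc _ = |κ x ^ 2 * (redH l x⁻¹ (ϖ x) (Q x) - redH l x⁻¹ (ϖ' x) (Q' x))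
              + (κ x + κ' x) * (κ x - κ' x) * redH l x⁻¹ (ϖ' x) (Q' x)| := by ring_nf
          _ ≤ |κ x| ^ 2 * |redH l x⁻¹ (ϖ x) (Q x) - redH l x⁻¹ (ϖ' x) (Q' x)|
              + |κ x + κ' x| * |κ x - κ' x| * |redH l x⁻¹ (ϖ' x) (Q' x)| := by
            rw [← abs_pow, ← abs_mul, ← abs_mul, ← abs_mul]; exact abs_add_le _ _
          _ ≤ K ^ 2 * (4 * K ^ 5 * N * (1 - rp / x)) + (K + K) * (N * (1 - rp / x)) * K := by
            gcongr
            exact (abs_add_le _ _).trans (add_le_add b1 b1')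
          _ = 4 * K ^ 7 * (N * (1 - rp / x)) + 2 * K ^ 2 * (N * (1 - rp / x)) := by ring
          _ ≤ 4 * K ^ 7 * (N * (1 - rp / x)) + 2 * K ^ 7 * (N * (1 - rp / x)) := by gcongr
          _ = _ := by ring
      have hdP : |redP l κ ϖ Q A x - redP l κ' ϖ' Q' A' x| ≤ L * N := by
        refine (abs_div_sub_div_le hc t0 b5 b5' b6' (hAN x hx) hdD).trans ?_
        calc _ = (2 * K ^ 2 / c + K * (6 * K ^ 7) / c ^ 2) * N := by ring
          _ ≤ L * N := by gcongr
      have hLN : N ≤ L * N := le_mul_of_one_le_left hN hL1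
      refine rhs_sub_le hL1 hN (hKm.trans hKL) (hKq.trans hKL)
        (by rw [abs_of_pos hux0]; linarith)
        ⟨by simpa using b1.trans hKL, by simpa using b1'.trans hKL, by simp; linarith⟩
        ⟨by simpa using b2.trans hKL, by simpa using b2'.trans hKL, by simp; linarith⟩
        ⟨by simpa using b3.trans hKL, by simpa using b3'.trans hKL, by simpa using hdP⟩
        ⟨by simpa using b4.trans hKL, by simpa using b4'.trans hKL, ?_⟩
        (hs.a_le x hx) (hs'.a_le x hx) (ha x hx) (hs.b_le x hx) (hs'.b_le x hx) (hb x hx)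
      simp only [Nat.cast_one, pow_one, one_mul]
      refine hdH.trans ?_
      calc 4 * K ^ 5 * N * (1 - rp / x) = 4 * K ^ 5 * (N * (1 - rp / x)) := by ring
        _ ≤ L * N := by gcongr
    have hgen : ∀ (g g' R R' : ℝ → ℝ) (g0 r : ℝ), rp < r →
        (∀ x, rp < x → HasDerivAt g (x ^ (-1 - 2 * Δ) * R x) x) →
        (∀ x, rp < x → HasDerivAt g' (x ^ (-1 - 2 * Δ) * R' x) x) →
        Tendsto g (nhdsWithin rp (Ioi rp)) (nhds g0) →
        Tendsto g' (nhdsWithin rp (Ioi rp)) (nhds g0) →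
        (∀ x, rp < x → |R x - R' x| ≤ 48 * L ^ 12 * (δ ^ 2 * N + δ * η)) →
        |g r - g' r| ≤ (D * δ * η + N / 2) * (1 - rp / r) := by
      intro g g' R R' g0 r hr hg hg' hg0 hg0' hR
      have h1 := hT (g - g') _ (g0 - g0) (48 * L ^ 12 * (δ ^ 2 * N + δ * η)) r hr (by positivity)
        (fun x hx => (hg x hx).sub (hg' x hx)) (hg0.sub hg0') (fun x hx => by
          have hsx : 0 < x ^ (-1 - 2 * Δ) := rpow_pos_of_pos (hrp.trans hx.1) _
          rw [← mul_sub, abs_mul, abs_of_pos hsx, mul_comm]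
          gcongr
          exact hR x hx.1)
      simp only [Pi.sub_apply, sub_self, sub_zero] at h1
      refine h1.trans ?_
      have := (ht r hr).1
      gcongr
      calc T * (48 * L ^ 12 * (δ ^ 2 * N + δ * η)) = D * δ * η + D * δ ^ 2 * N := by rw [hD]; ring
        _ ≤ D * δ * η + 1 / 2 * N := by gcongr
        _ = _ := by ring
    exact fun r hr =>
      ⟨hgen κ κ' _ _ κp r hr hs.κ_deriv hs'.κ_deriv hs.κ_lim hs'.κ_lim
        fun x hx => (hrhs x hx).1,
      hgen ϖ ϖ' _ _ M r hr hs.ϖ_deriv hs'.ϖ_deriv hs.ϖ_lim hs'.ϖ_lim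
        fun x hx => (hrhs x hx).2.1,
      hgen Q Q' _ _ e r hr hs.Q_deriv hs'.Q_deriv hs.Q_lim hs'.Q_lim
        fun x hx => (hrhs x hx).2.2⟩
  have hiter : ∀ k : ℕ, V (2 * D * δ * η + 2 / 2 ^ k) := by
    intro k
    induction k with
    | zero =>
      intro r hr
      obtain ⟨-, -, -, -, -, -, b1, b2, b3⟩ := B r hr
      obtain ⟨-, -, -, -, -, -, b1', b2', b3'⟩ := B' r hr
      have hpos : 0 ≤ 2 * D * δ * η * (1 - rp / r) := by
        have := (ht r hr).1
        positivity
      have key : ∀ x y z : ℝ, |x - z| ≤ 1 - rp / r → |y - z| ≤ 1 - rp / r →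
          |x - y| ≤ (2 * D * δ * η + 2 / 2 ^ 0) * (1 - rp / r) := by
        intro x y z hx hy
        rw [abs_le] at *
        rw [pow_zero, div_one, add_mul]
        constructor <;> linarith [hx.1, hx.2, hy.1, hy.2]
      exact ⟨key _ _ _ b1 b1', key _ _ _ b2 b2', key _ _ _ b3 b3'⟩
    | succ k ih =>
      have := hstep _ (by positivity) ih
      convert this using 1
      rw [pow_succ]
      field_simp
      ring
  have hlim : Tendsto (fun k : ℕ => 2 * D * δ * η + 2 / 2 ^ k) atTop (nhds (2 * D * δ * η)) := by
    have h1 := (tendsto_pow_atTop_nhds_zero_of_lt_one (by norm_num : (0:ℝ) ≤ 1 / 2)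
      (by norm_num)).const_mul 2 |>.const_add (2 * D * δ * η)
    simpa [div_eq_mul_inv] using h1
  have hV : V (2 * D * δ * η) := fun r hr =>
    ⟨ge_of_tendsto' (hlim.mul_const _) fun k => (hiter k r hr).1,
     ge_of_tendsto' (hlim.mul_const _) fun k => (hiter k r hr).2.1,
     ge_of_tendsto' (hlim.mul_const _) fun k => (hiter k r hr).2.2⟩
  intro r hr
  obtain ⟨v1, v2, v3⟩ := hV r hr
  have v4 := hA _ (by positivity) hV r hr
  obtain ⟨t0, t1⟩ := ht r hr
  have hpos : 0 ≤ 2 * D * δ * η := by positivity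
  have hK' : 1 ≤ 2 * K ^ 2 := by nlinarith
  have h1 : 2 * D * δ * η * (1 - rp / r) ≤ 2 * D * (2 * K ^ 2) * δ * η := by
    calc _ ≤ 2 * D * δ * η * 1 := by gcongr
      _ ≤ 2 * D * δ * η * (2 * K ^ 2) := by gcongr
      _ = _ := by ring
  refine ⟨v1.trans h1, v2.trans h1, v3.trans h1, v4.trans ?_⟩
  calc _ ≤ 2 * K ^ 2 * (2 * D * δ * η) * 1 := by gcongr
    _ = _ := by ring

/-- Solutions of the auxiliary system solve the renormalised system. -/
theorem redSystem_of_auxSystem {Λ M e rp α Δ q0 ε δ Kp κp : ℝ} {W f κ Ω2 ϖ Q A : ℝ → ℝ}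
    (hrp : 0 < rp) (hX : XnormLE rp Δ W f δ) (hS : AuxSystem Λ α q0 rp f κ Ω2 ϖ Q A)
    (hH : AuxHorizon Λ α rp M e ε κ Ω2 ϖ Q A) (hA : Tendsto A (nhdsWithin rp (Ioi rp)) (nhds 0))
    (hKp : Kp = M / rp ^ 2 - e ^ 2 / rp ^ 3 + (-Λ / 3) * rp)
    (hκp : κp = (1 - (-Λ / 3) * α * rp * ε ^ 2 / (2 * Kp))⁻¹) :
    RedSystem rp (-Λ / 3) ((-Λ / 3) * α / 2) (q0 ^ 2) Δ κp M e (e / (2 * Kp)) δ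
      (fun r => r ^ ((3:ℝ) / 2 + Δ) * f r) (fun r => r ^ ((5:ℝ) / 2 + Δ) * deriv f r) κ ϖ Q A := by
  obtain ⟨cκ, -, cϖ, cQ, cA, κpos, Ωpos, e1, e2, e3, e4, e5⟩ := hS
  obtain ⟨Kp', κp', hK', hK0, hκ', lϖ, lQ, lκ, lP, -⟩ := hH
  obtain rfl : Kp' = Kp := hK'.trans hKp.symm
  obtain rfl : κp' = κp := hκ'.trans hκp.symm
  obtain ⟨d1, d2, d3, h1, h2, h3, hd, hx1, hx2, -⟩ := hX
  have hder : ∀ g : ℝ → ℝ, ContDiffOn ℝ 1 g (Ioi rp) → ∀ r, rp < r →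
      HasDerivAt g (deriv g r) r := fun g hg r hr =>
    ((hg.differentiableOn (by norm_num)).differentiableAt (Ioi_mem_nhds hr)).hasDerivAt
  have hHeq : ∀ r, rp < r → redH (-Λ / 3) r⁻¹ (ϖ r) (Q r) = Ω2 r / (κ r ^ 2 * r ^ 2) := by
    intro r hr
    have hr0 : r ≠ 0 := (hrp.trans hr).ne'
    have hκ0 := (κpos r hr).ne'
    have h := e2 r hr
    rw [← div_div, h]
    unfold redH
    field_simp
    ring
  have hP : ∀ r, rp < r → redP (-Λ / 3) κ ϖ Q A r = r ^ 2 * (A r / Ω2 r) := by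
    intro r hr
    have hr0 : r ≠ 0 := (hrp.trans hr).ne'
    have hκ0 := (κpos r hr).ne'
    have hΩ0 := (Ωpos r hr).ne'
    unfold redP
    rw [hHeq r hr]
    field_simp
  have hs : ∀ r, rp < r → 0 < r ^ ((3:ℝ) / 2 + Δ) ∧
      r ^ (-1 - 2 * Δ) = r ^ 2 / (r ^ ((3:ℝ) / 2 + Δ)) ^ 2 ∧
      r ^ ((5:ℝ) / 2 + Δ) = r ^ ((3:ℝ) / 2 + Δ) * r := by
    intro r hr
    have hr0 : 0 < r := hrp.trans hr
    have hρ := rpow_pos_of_pos hr0 ((3:ℝ) / 2 + Δ)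
    refine ⟨hρ, ?_, ?_⟩
    · rw [eq_div_iff (pow_ne_zero 2 hρ.ne'), ← Real.rpow_natCast, ← Real.rpow_mul hr0.le,
        ← Real.rpow_add hr0, ← Real.rpow_natCast]
      congr 1
      push_cast
      ring
    · rw [← Real.rpow_add_one hr0.ne']
      congr 1
      ring
  refine ⟨κpos, ?_, ?_, ?_, ?_, ?_, lκ, lϖ, lQ, hA, ?_, ?_, ?_⟩
  · intro r hr
    rw [hHeq r hr]
    have := κpos r hr
    have := Ωpos r hr
    have : 0 < r := hrp.trans hr
    positivity
  · intro r hr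
    refine (hder κ cκ r hr).congr_deriv ?_
    have hr0 : r ≠ 0 := (hrp.trans hr).ne'
    have hκ0 := (κpos r hr).ne'
    have hΩ0 := (Ωpos r hr).ne'
    have h := e1 r hr
    rw [div_eq_iff hκ0] at h
    obtain ⟨hρ, s1, s2⟩ := hs r hr
    rw [h, hP r hr, s1, s2]
    unfold rhsκ
    generalize r ^ ((3:ℝ) / 2 + Δ) = ρ at *
    field_simp
  · intro r hr
    refine (hder ϖ cϖ r hr).congr_deriv ?_
    have hr0 : r ≠ 0 := (hrp.trans hr).ne'
    have hκ0 := (κpos r hr).ne'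
    have hΩ0 := (Ωpos r hr).ne'
    have h := e3 r hr
    obtain ⟨hρ, s1, s2⟩ := hs r hr
    rw [h, hP r hr, s1, s2, hHeq r hr]
    unfold rhsϖ
    generalize r ^ ((3:ℝ) / 2 + Δ) = ρ at *
    field_simp
  · intro r hr
    refine (hder Q cQ r hr).congr_deriv ?_
    have hr0 : r ≠ 0 := (hrp.trans hr).ne'
    have hΩ0 := (Ωpos r hr).ne'
    have h := e4 r hr
    obtain ⟨hρ, s1, s2⟩ := hs r hr
    rw [h, hP r hr, s1]
    unfold rhsQ
    generalize r ^ ((3:ℝ) / 2 + Δ) = ρ at *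
    field_simp
  · intro r hr
    refine (hder A cA r hr).congr_deriv ?_
    rw [e5 r hr, inv_pow, div_eq_mul_inv]
  · have h : Tendsto (fun r => r ^ 2 * (A r / Ω2 r)) (nhdsWithin rp (Ioi rp))
        (nhds (rp ^ 2 * (e / (2 * Kp' * rp ^ 2)))) :=
      (((continuous_pow 2).tendsto rp).mono_left nhdsWithin_le_nhds).mul lP
    have h' : rp ^ 2 * (e / (2 * Kp' * rp ^ 2)) = e / (2 * Kp') := by
      field_simp
    rw [h'] at h
    refine h.congr' ?_
    filter_upwards [self_mem_nhdsWithin] with r hr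
    exact (hP r hr).symm
  · exact fun r hr => (hx1 r hr).trans (by linarith)
  · exact fun r hr => (hx2 r hr).trans (by linarith)

theorem stmt_17 (Λ M e rp α Δ q0 : ℝ) (hΛ : Λ < 0)
    (hsub : IsSubExtremal Λ M e rp)
    (hα : α ∈ Ioo (-(9:ℝ)/4) 0) (hΔ : Δ = Real.sqrt (9/4 + α)) :
    ∃ C > (0:ℝ), ∃ ε₀ > (0:ℝ), ∃ δ₀ > (0:ℝ),
      ∀ ε δ : ℝ, 0 < ε → ε < ε₀ → 0 < δ → δ < δ₀ →
      ∀ f₁ f₂ : ℝ → ℝ,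
        ContDiffOn ℝ 2 f₁ (Ioi rp) → ContDiffOn ℝ 2 f₂ (Ioi rp) →
        XnormLE rp Δ (RNpot Λ M e) f₁ δ →
        XnormLE rp Δ (RNpot Λ M e) f₂ δ →
        ∀ κ₁ Ω2₁ ϖ₁ Q₁ A₁ κ₂ Ω2₂ ϖ₂ Q₂ A₂ : ℝ → ℝ,
          AuxSystem Λ α q0 rp f₁ κ₁ Ω2₁ ϖ₁ Q₁ A₁ →
          AuxSystem Λ α q0 rp f₂ κ₂ Ω2₂ ϖ₂ Q₂ A₂ →
          -- the same horizon data for the two solutions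
          AuxHorizon Λ α rp M e ε κ₁ Ω2₁ ϖ₁ Q₁ A₁ →
          AuxHorizon Λ α rp M e ε κ₂ Ω2₂ ϖ₂ Q₂ A₂ →
          Tendsto A₁ (nhdsWithin rp (Ioi rp)) (nhds 0) →
          Tendsto A₂ (nhdsWithin rp (Ioi rp)) (nhds 0) →
          -- for every bound η on ‖f₁ − f₂‖_X (in particular η = ‖f₁ − f₂‖_X):
          ∀ η : ℝ, XnormLE rp Δ (RNpot Λ M e) (fun r => f₁ r - f₂ r) η →
            ∀ r ∈ Ioi rp,
              |κ₁ r - κ₂ r| ≤ C*δ*η ∧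
              |ϖ₁ r - ϖ₂ r| ≤ C*δ*η ∧
              |Q₁ r - Q₂ r| ≤ C*δ*η ∧
              |A₁ r - A₂ r| ≤ C*δ*η := by
  obtain ⟨hrp, hW, -, -⟩ := hsub
  obtain ⟨hα1, hα2⟩ := hα
  have hΔ0 : 0 < Δ := by rw [hΔ]; exact Real.sqrt_pos.2 (by linarith)
  have hΔ1 : Δ ≤ 3 / 2 := by
    rw [hΔ]
    exact Real.sqrt_le_iff.2 ⟨by norm_num, by linarith⟩
  by_cases hKp : 0 < M / rp ^ 2 - e ^ 2 / rp ^ 3 + (-Λ / 3) * rp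
  swap
  · refine ⟨1, one_pos, 1, one_pos, 1, one_pos, ?_⟩
    intro ε δ _ _ _ _ f₁ f₂ _ _ _ _ κ₁ Ω2₁ ϖ₁ Q₁ A₁ κ₂ Ω2₂ ϖ₂ Q₂ A₂ _ _ h₁
    obtain ⟨Kp, κp, rfl, h, -⟩ := h₁
    exact absurd h hKp
  have hl : 0 < -Λ / 3 := by linarith
  have hW' : RNpot (-3 * (-Λ / 3)) M e rp = 0 := by
    rwa [show -3 * (-Λ / 3) = Λ by ring]
  obtain ⟨Kp, hKdef⟩ : ∃ Kp, Kp = M / rp ^ 2 - e ^ 2 / rp ^ 3 + (-Λ / 3) * rp := ⟨_, rfl⟩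
  have hKp' : 0 < Kp := hKdef ▸ hKp
  obtain ⟨C, δ₀, hC, hδ₀, hmain⟩ := exists_redSystem_lipschitz (m := (-Λ / 3) * α / 2)
    (q := q0 ^ 2) (p0 := e / (2 * Kp)) hrp hΔ0 hΔ1 hl hW' hKp
  obtain ⟨z, hz⟩ : ∃ z, z = -((-Λ / 3) * α * rp / (2 * Kp)) := ⟨_, rfl⟩
  have hz0 : 0 < z := by
    have : 0 < (-Λ / 3) * (-α) * rp / (2 * Kp) := by
      have : 0 < -α := by linarith
      positivity
    rw [hz]
    convert this using 1
    ring
  refine ⟨C, hC, min 1 (1 / z), by positivity, δ₀, hδ₀, ?_⟩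
  intro ε δ hε hε0 hδ hδ0 f₁ f₂ hf₁ hf₂ hX₁ hX₂ κ₁ Ω2₁ ϖ₁ Q₁ A₁ κ₂ Ω2₂ ϖ₂ Q₂ A₂ hS₁ hS₂ hH₁ hH₂
    hA₁ hA₂ η hη
  rw [lt_min_iff, lt_div_iff₀ hz0] at hε0
  obtain ⟨κp, hκp⟩ : ∃ κp, κp = (1 - (-Λ / 3) * α * rp * ε ^ 2 / (2 * Kp))⁻¹ := ⟨_, rfl⟩
  have hκp_eq : κp = (1 + z * ε ^ 2)⁻¹ := by
    rw [hκp, hz]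
    congr 1
    ring
  have hzε : z * ε ^ 2 ≤ 1 := by nlinarith [mul_pos hε hz0]
  have hzε0 : 0 ≤ z * ε ^ 2 := by positivity
  have hκp1 : 1 / 2 ≤ κp := by
    rw [hκp_eq, one_div]
    exact inv_anti₀ (by linarith) (by linarith)
  have hκp2 : κp ≤ 1 := by
    rw [hκp_eq]
    exact inv_le_one_of_one_le₀ (by linarith)
  have hR₁ := redSystem_of_auxSystem hrp hX₁ hS₁ hH₁ hA₁ hKdef hκp
  have hR₂ := redSystem_of_auxSystem hrp hX₂ hS₂ hH₂ hA₂ hKdef hκp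
  obtain ⟨d1, d2, d3, h1, h2, h3, hd, hx1, hx2, -⟩ := hη
  refine hmain κp δ η _ _ κ₁ ϖ₁ Q₁ A₁ _ _ κ₂ ϖ₂ Q₂ A₂ hκp1 hκp2 hδ hδ0 hR₁ hR₂ ?_ ?_
  · intro r hr
    rw [← mul_sub]
    exact (hx1 r hr).trans (by linarith)
  · intro r hr
    have g₁ := (hf₁.differentiableOn (by norm_num)).differentiableAt (Ioi_mem_nhds hr)
    have g₂ := (hf₂.differentiableOn (by norm_num)).differentiableAt (Ioi_mem_nhds hr)
    have h := hx2 r hr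
    rw [deriv_fun_sub g₁ g₂] at h
    rw [← mul_sub]
    exact h.trans (by linarith)
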